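/- Let m, n ≥ 3 be integers. Then the Seidel energy strictly decreases under Type-I hyperedge deletion: the sum of the absolute values of the eigenvalues of S(m,n) is strictly greater than the sum of the absolute values of the eigenvalues of S_I(m,n); that is, E_S(C^3_{m,n}) > E_S(C^3_{m,n} - e) for a hyperedge e containing one vertex of the first block and two vertices of the second block. -/

import Mathlib

open Polynomial Matrix

/-- The Seidel matrix of the complete 3-uniform bipartite hypergraph `C³_{m,n}`. -/
noncomputable def seidelS (m n : ℕ) : Matrix (Fin m ⊕ Fin n) (Fin m ⊕ Fin n) ℝ :=
  fun i j =>
    if i = j then 0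
    else
      match i, j with
      | Sum.inl _, Sum.inl _ => 1 - 2 * (n : ℝ)
      | Sum.inr _, Sum.inr _ => 1 - 2 * (m : ℝ)
      | _, _ => 1 - 2 * ((m : ℝ) + (n : ℝ) - 2)

/-- Type-I hyperedge-deleted Seidel matrix. -/
noncomputable def seidelI (m n : ℕ) : Matrix (Fin m ⊕ Fin n) (Fin m ⊕ Fin n) ℝ :=
  fun i j =>
    match i, j with
    | Sum.inl a, Sum.inr b =>
        if a.val = 0 ∧ b.val ≤ 1 then 1 - 2 * ((m : ℝ) + (n : ℝ) - 3)
        else seidelS m n (Sum.inl a) (Sum.inr b)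
    | Sum.inr b, Sum.inl a =>
        if a.val = 0 ∧ b.val ≤ 1 then 1 - 2 * ((m : ℝ) + (n : ℝ) - 3)
        else seidelS m n (Sum.inr b) (Sum.inl a)
    | Sum.inr a, Sum.inr b =>
        if (a.val = 0 ∧ b.val = 1) ∨ (a.val = 1 ∧ b.val = 0) then 1 - 2 * ((m : ℝ) - 1)
        else seidelS m n (Sum.inr a) (Sum.inr b)
    | Sum.inl a, Sum.inl b => seidelS m n (Sum.inl a) (Sum.inl b)

/-- Type-II hyperedge-deleted Seidel matrix. -/
noncomputable def seidelII (m n : ℕ) : Matrix (Fin m ⊕ Fin n) (Fin m ⊕ Fin n) ℝ :=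
  fun i j =>
    match i, j with
    | Sum.inl a, Sum.inl b =>
        if (a.val = 0 ∧ b.val = 1) ∨ (a.val = 1 ∧ b.val = 0) then 1 - 2 * ((n : ℝ) - 1)
        else seidelS m n (Sum.inl a) (Sum.inl b)
    | Sum.inl a, Sum.inr b =>
        if a.val ≤ 1 ∧ b.val = 0 then 1 - 2 * ((m : ℝ) + (n : ℝ) - 3)
        else seidelS m n (Sum.inl a) (Sum.inr b)
    | Sum.inr b, Sum.inl a =>
        if a.val ≤ 1 ∧ b.val = 0 then 1 - 2 * ((m : ℝ) + (n : ℝ) - 3)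
        else seidelS m n (Sum.inr b) (Sum.inl a)
    | Sum.inr a, Sum.inr b => seidelS m n (Sum.inr a) (Sum.inr b)

/-- Seidel energy: sum of absolute values of the eigenvalues (roots of the
characteristic polynomial, with multiplicity). -/
noncomputable def seidelEnergy {k : Type*} [Fintype k] [DecidableEq k]
    (M : Matrix k k ℝ) : ℝ :=
  (M.charpoly.roots.map (fun x => |x|)).sum

namespace Matrix

variable {k : Type*} [Fintype k]

lemma dotProduct_mulVec_eq_sum (A : Matrix k k ℝ) (x : k → ℝ) :
    x ⬝ᵥ (A *ᵥ x) = ∑ i, ∑ j, A i j * (x i * x j) := by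
  simp only [dotProduct, mulVec, Finset.mul_sum]
  exact Finset.sum_congr rfl fun i _ => Finset.sum_congr rfl fun j _ => by ring

lemma dotProduct_abs_mulVec_le {A : Matrix k k ℝ} (hdiag : ∀ i, A i i = 0)
    (hneg : ∀ i j, i ≠ j → A i j < 0) (x : k → ℝ) :
    |x| ⬝ᵥ (A *ᵥ |x|) ≤ x ⬝ᵥ (A *ᵥ x) := by
  rw [dotProduct_mulVec_eq_sum, dotProduct_mulVec_eq_sum]
  refine Finset.sum_le_sum fun i _ => Finset.sum_le_sum fun j _ => ?_
  rcases eq_or_ne i j with rfl | hij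
  · simp [hdiag]
  · rw [Pi.abs_apply, Pi.abs_apply, ← abs_mul]
    exact mul_le_mul_of_nonpos_left (le_abs_self _) (hneg i j hij).le

/-- A nonzero nonnegative eigenvector of a matrix with negative off-diagonal entries is positive. -/
lemma eigenvector_pos_of_nonneg {A : Matrix k k ℝ} {c : ℝ} (hneg : ∀ i j, i ≠ j → A i j < 0)
    {w : k → ℝ} (hw : 0 ≤ w) (hw0 : w ≠ 0) (hAw : A *ᵥ w = c • w) (i : k) : 0 < w i := by
  refine lt_of_le_of_ne (hw i) fun hi => ?_
  obtain ⟨j, hj⟩ := Function.ne_iff.1 hw0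
  have hsum : ∑ l, A i l * w l = 0 := by
    have := congrFun hAw i
    simpa [mulVec, dotProduct, ← hi] using this
  have hterm : ∀ l ∈ Finset.univ, A i l * w l ≤ 0 := by
    intro l _
    rcases eq_or_ne i l with rfl | hil
    · simp [← hi]
    · exact mul_nonpos_of_nonpos_of_nonneg (hneg i l hil).le (hw l)
  have h0 := (Finset.sum_eq_zero_iff_of_nonpos hterm).1 hsum j (Finset.mem_univ j)
  have hij : i ≠ j := by
    rintro rfl
    exact hj hi.symm
  exact (mul_ne_zero (hneg i j hij).ne hj) h0

variable [DecidableEq k]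

lemma seidelEnergy_eq_sum_abs_eigenvalues {A : Matrix k k ℝ} (hA : A.IsHermitian) :
    seidelEnergy A = ∑ i, |hA.eigenvalues i| := by
  simp [seidelEnergy, hA.roots_charpoly_eq_eigenvalues]

lemma seidelEnergy_eq_sum_abs_sub {A : Matrix k k ℝ} (hA : A.IsHermitian) (htr : A.trace = 0) :
    seidelEnergy A = ∑ i, (|hA.eigenvalues i| - hA.eigenvalues i) := by
  have h : ∑ i, hA.eigenvalues i = 0 := by
    simpa [htr] using hA.trace_eq_sum_eigenvalues.symm
  rw [seidelEnergy_eq_sum_abs_eigenvalues hA, Finset.sum_sub_distrib, h, sub_zero]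

/-- A traceless real symmetric matrix has energy at least `-2` times any of its eigenvalues. -/
lemma neg_two_mul_eigenvalue_le_seidelEnergy {A : Matrix k k ℝ} (hA : A.IsHermitian)
    (htr : A.trace = 0) (j : k) : -2 * hA.eigenvalues j ≤ seidelEnergy A := by
  rw [seidelEnergy_eq_sum_abs_sub hA htr]
  calc -2 * hA.eigenvalues j ≤ |hA.eigenvalues j| - hA.eigenvalues j := by
        linarith [neg_abs_le (hA.eigenvalues j)]
    _ ≤ _ := Finset.single_le_sum (f := fun i => |hA.eigenvalues i| - hA.eigenvalues i)
        (fun i _ => sub_nonneg.2 (le_abs_self _)) (Finset.mem_univ j)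

/-- If only one eigenvalue of a traceless real symmetric matrix is negative, it determines
the energy. -/
lemma seidelEnergy_eq_neg_two_mul_eigenvalue {A : Matrix k k ℝ} (hA : A.IsHermitian)
    (htr : A.trace = 0) (j : k) (hj : hA.eigenvalues j < 0)
    (h : ∀ i, i ≠ j → 0 ≤ hA.eigenvalues i) : seidelEnergy A = -2 * hA.eigenvalues j := by
  rw [seidelEnergy_eq_sum_abs_sub hA htr, Finset.sum_eq_single j]
  · rw [abs_of_neg hj]; ring
  · intro i _ hi
    rw [abs_of_nonneg (h i hi), sub_self]
  · simp

lemma posSemidef_sub_smul_one {A : Matrix k k ℝ} (hA : A.IsHermitian) {c : ℝ}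
    (h : ∀ i, c ≤ hA.eigenvalues i) : (A - c • (1 : Matrix k k ℝ)).PosSemidef := by
  have hB : (A - c • (1 : Matrix k k ℝ)).IsHermitian := by
    refine hA.sub ?_
    simp [IsHermitian]
  refine hB.posSemidef_iff_eigenvalues_nonneg.2 fun j => ?_
  have hmem := hB.eigenvalues_mem_spectrum_real j
  have hmem' : hB.eigenvalues j + c ∈ spectrum ℝ A := by
    rw [spectrum.mem_iff] at hmem ⊢
    convert hmem using 2
    rw [map_add, Algebra.algebraMap_eq_smul_one c]
    abel
  rw [hA.spectrum_real_eq_range_eigenvalues] at hmem'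
  obtain ⟨i, hi⟩ := hmem'
  have := h i
  simp only [Pi.zero_apply]
  linarith

lemma dotProduct_sub_smul_one_mulVec (A : Matrix k k ℝ) (c : ℝ) (x : k → ℝ) :
    x ⬝ᵥ ((A - c • (1 : Matrix k k ℝ)) *ᵥ x) = x ⬝ᵥ (A *ᵥ x) - c * (x ⬝ᵥ x) := by
  simp [sub_mulVec, smul_mulVec, dotProduct_sub]

lemma eigenvectorBasis_dotProduct {A : Matrix k k ℝ} (hA : A.IsHermitian) (i j : k) :
    (hA.eigenvectorBasis i).ofLp ⬝ᵥ (hA.eigenvectorBasis j).ofLp = if i = j then 1 else 0 := by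
  have := orthonormal_iff_ite.1 hA.eigenvectorBasis.orthonormal j i
  rw [EuclideanSpace.inner_eq_star_dotProduct] at this
  simpa [eq_comm] using this

/-- A symmetric matrix that is positive on the hyperplane of vectors with zero sum has at most
one negative eigenvalue. -/
lemma eigenvalues_nonneg_of_pos_on_sum_zero {A : Matrix k k ℝ} (hA : A.IsHermitian)
    (h : ∀ x : k → ℝ, x ≠ 0 → ∑ i, x i = 0 → 0 < x ⬝ᵥ (A *ᵥ x)) {i j : k} (hij : i ≠ j)
    (hj : hA.eigenvalues j < 0) : 0 ≤ hA.eigenvalues i := by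
  by_contra! hi
  set u := (hA.eigenvectorBasis i).ofLp with hu
  set v := (hA.eigenvectorBasis j).ofLp with hv
  have huu : u ⬝ᵥ u = 1 := by simp [hu, eigenvectorBasis_dotProduct]
  have hvv : v ⬝ᵥ v = 1 := by simp [hv, eigenvectorBasis_dotProduct]
  have huv : u ⬝ᵥ v = 0 := by simp [hu, hv, eigenvectorBasis_dotProduct, hij]
  have hvu : v ⬝ᵥ u = 0 := by rw [dotProduct_comm, huv]
  have hAu : A *ᵥ u = hA.eigenvalues i • u := hA.mulVec_eigenvectorBasis i
  have hAv : A *ᵥ v = hA.eigenvalues j • v := hA.mulVec_eigenvectorBasis j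
  have key : ∀ a b : ℝ, (a • u + b • v) ⬝ᵥ (A *ᵥ (a • u + b • v))
      = a ^ 2 * hA.eigenvalues i + b ^ 2 * hA.eigenvalues j := by
    intro a b
    simp only [mulVec_add, mulVec_smul, hAu, hAv, add_dotProduct, dotProduct_add, smul_dotProduct,
      dotProduct_smul, huu, hvv, huv, hvu, smul_eq_mul]
    ring
  have hlin : ∀ a b : ℝ, a * (∑ l, u l) + b * (∑ l, v l) = 0 → a = 0 := by
    intro a b hab
    by_contra ha
    refine absurd (h (a • u + b • v) ?_ ?_) ?_
    · intro h0
      have := congrArg (u ⬝ᵥ ·) h0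
      simp [dotProduct_add, dotProduct_smul, huu, huv] at this
      exact ha this
    · simpa [Finset.sum_add_distrib, Finset.mul_sum] using hab
    · rw [key]
      nlinarith [mul_nonneg (sq_nonneg a) (neg_pos.2 hi).le,
        mul_nonneg (sq_nonneg b) (neg_pos.2 hj).le]
  have hv0 : ∑ l, v l = 0 := hlin (∑ l, v l) (-∑ l, u l) (by ring)
  simpa using hlin 1 0 (by
    by_contra hne
    have hv_ne : v ≠ 0 := by rintro h0; simp [h0] at hvv
    have := h v hv_ne hv0
    rw [hAv, dotProduct_smul, hvv] at this
    simp at this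
    linarith)

/-- Comparison of energies for symmetric matrices with zero diagonal and negative off-diagonal
entries: raising entries strictly lowers the energy, provided that the larger matrix is positive
on the hyperplane of vectors with zero sum. -/
theorem seidelEnergy_lt_of_le {A B : Matrix k k ℝ} (hA : A.IsHermitian) (hB : B.IsHermitian)
    (hAdiag : ∀ i, A i i = 0) (hBdiag : ∀ i, B i i = 0) (hBneg : ∀ i j, i ≠ j → B i j < 0)
    (hle : ∀ i j, A i j ≤ B i j) {p q : k} (hlt : A p q < B p q)
    (hpos : ∀ x : k → ℝ, x ≠ 0 → ∑ i, x i = 0 → 0 < x ⬝ᵥ (B *ᵥ x)) :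
    seidelEnergy B < seidelEnergy A := by
  have hAneg : ∀ i j, i ≠ j → A i j < 0 := fun i j hij => (hle i j).trans_lt (hBneg i j hij)
  have hpq : p ≠ q := by
    rintro rfl
    simp [hAdiag, hBdiag] at hlt
  have hAtr : A.trace = 0 := by simp [trace, hAdiag]
  have hBtr : B.trace = 0 := by simp [trace, hBdiag]
  obtain ⟨j, hj⟩ : ∃ j, hB.eigenvalues j < 0 := by
    by_contra! hall
    have h1 := (hB.posSemidef_iff_eigenvalues_nonneg.2 hall).dotProduct_mulVec_nonneg
      (fun _ => (1 : ℝ))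
    have h2 : (fun _ : k => (1 : ℝ)) ⬝ᵥ (B *ᵥ fun _ => (1 : ℝ)) < 0 := by
      rw [dotProduct_mulVec_eq_sum, ← Finset.sum_product']
      have hnonpos : ∀ i j, B i j ≤ 0 := by
        intro i j
        rcases eq_or_ne i j with rfl | hij
        exacts [(hBdiag i).le, (hBneg i j hij).le]
      exact Finset.sum_neg' (fun x _ => by simpa using hnonpos x.1 x.2)
        ⟨(p, q), by simp, by simpa using hBneg p q hpq⟩
    exact absurd h1 (not_le.2 (by simpa [Pi.star_def] using h2))
  set μ := hB.eigenvalues j with hμ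
  rw [seidelEnergy_eq_neg_two_mul_eigenvalue hB hBtr j hj fun i hi =>
    eigenvalues_nonneg_of_pos_on_sum_zero hB hpos hi hj]
  obtain ⟨i, hi⟩ : ∃ i, hA.eigenvalues i < μ := by
    by_contra! hall
    have hpsd := posSemidef_sub_smul_one hA hall
    set v := (hB.eigenvectorBasis j).ofLp with hv
    have hvv : v ⬝ᵥ v = 1 := by simp [hv, eigenvectorBasis_dotProduct]
    have hBv : B *ᵥ v = μ • v := hB.mulVec_eigenvectorBasis j
    have hww : |v| ⬝ᵥ |v| = 1 := by
      rw [← hvv]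
      simp [dotProduct]
    have hw : 0 ≤ |v| := abs_nonneg v
    have hw0 : |v| ≠ 0 := by
      intro h0
      simp [h0] at hww
    have hBw : |v| ⬝ᵥ (B *ᵥ |v|) ≤ μ := by
      refine (dotProduct_abs_mulVec_le hBdiag hBneg v).trans_eq ?_
      rw [hBv, dotProduct_smul, hvv, smul_eq_mul, mul_one]
    have hterm : ∀ i j, A i j * (|v| i * |v| j) ≤ B i j * (|v| i * |v| j) := fun i j =>
      mul_le_mul_of_nonneg_right (hle i j) (mul_nonneg (hw i) (hw j))
    have hAB : |v| ⬝ᵥ (A *ᵥ |v|) ≤ |v| ⬝ᵥ (B *ᵥ |v|) := by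
      rw [dotProduct_mulVec_eq_sum, dotProduct_mulVec_eq_sum]
      exact Finset.sum_le_sum fun i _ => Finset.sum_le_sum fun j _ => hterm i j
    have hzero : |v| ⬝ᵥ ((A - μ • (1 : Matrix k k ℝ)) *ᵥ |v|) = 0 := by
      refine le_antisymm ?_ (by simpa using hpsd.dotProduct_mulVec_nonneg |v|)
      rw [dotProduct_sub_smul_one_mulVec, hww]
      linarith
    have hAw : A *ᵥ |v| = μ • |v| := by
      have := (hpsd.dotProduct_mulVec_zero_iff |v|).1 (by simpa using hzero)
      rw [sub_mulVec, smul_mulVec, one_mulVec, sub_eq_zero] at this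
      exact this
    have hvpos := eigenvector_pos_of_nonneg hAneg hw hw0 hAw
    have hABlt : |v| ⬝ᵥ (A *ᵥ |v|) < |v| ⬝ᵥ (B *ᵥ |v|) := by
      rw [dotProduct_mulVec_eq_sum, dotProduct_mulVec_eq_sum, ← Finset.sum_product',
        ← Finset.sum_product']
      exact Finset.sum_lt_sum (fun x _ => hterm x.1 x.2)
        ⟨(p, q), by simp, mul_lt_mul_of_pos_right hlt (mul_pos (hvpos p) (hvpos q))⟩
    rw [hAw, dotProduct_smul, hww, smul_eq_mul, mul_one] at hABlt
    exact absurd hBw (not_le.2 hABlt)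
  have := neg_two_mul_eigenvalue_le_seidelEnergy hA hAtr i
  linarith

end Matrix

lemma seidelS_isHermitian (m n : ℕ) : (seidelS m n).IsHermitian := by
  ext i j
  rcases i with i | i <;> rcases j with j | j <;> simp [seidelS, eq_comm]

/-- The indicator of the three vertices of the deleted Type-I hyperedge. -/
noncomputable def typeIEdge (m n : ℕ) : Fin m ⊕ Fin n → ℝ
  | Sum.inl a => if a.val = 0 then 1 else 0
  | Sum.inr b => if b.val ≤ 1 then 1 else 0

lemma typeIEdge_mul_self (m n : ℕ) (i : Fin m ⊕ Fin n) :
    typeIEdge m n i * typeIEdge m n i = typeIEdge m n i := by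
  rcases i with i | i <;> simp [typeIEdge]

lemma typeIEdge_nonneg (m n : ℕ) (i : Fin m ⊕ Fin n) : 0 ≤ typeIEdge m n i := by
  rcases i with i | i <;> simp only [typeIEdge] <;> split_ifs <;> norm_num

lemma typeIEdge_le_one (m n : ℕ) (i : Fin m ⊕ Fin n) : typeIEdge m n i ≤ 1 := by
  rcases i with i | i <;> simp only [typeIEdge] <;> split_ifs <;> norm_num

lemma seidelI_apply_self (m n : ℕ) (i : Fin m ⊕ Fin n) : seidelI m n i i = 0 := by
  rcases i with i | i <;> simp [seidelI, seidelS]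
  omega

lemma seidelI_apply_of_ne (m n : ℕ) {i j : Fin m ⊕ Fin n} (hij : i ≠ j) :
    seidelI m n i j = seidelS m n i j + 2 * (typeIEdge m n i * typeIEdge m n j) := by
  rcases i with i | i <;> rcases j with j | j
  · have h : ¬ (i.val = 0 ∧ j.val = 0) := fun h => hij (congrArg _ (Fin.ext (by omega)))
    simp only [seidelI, typeIEdge]
    split_ifs <;> first | omega | simp
  · simp only [seidelI, seidelS, typeIEdge, reduceCtorEq, if_false]
    split_ifs <;> first | omega | ring
  · simp only [seidelI, seidelS, typeIEdge, reduceCtorEq, if_false]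
    split_ifs <;> first | omega | ring
  · have h : i.val ≠ j.val := fun h => hij (congrArg _ (Fin.ext h))
    simp only [seidelI, seidelS, typeIEdge, if_neg hij]
    split_ifs <;> first | omega | ring

lemma seidelI_apply (m n : ℕ) (i j : Fin m ⊕ Fin n) :
    seidelI m n i j = seidelS m n i j + 2 * (typeIEdge m n i * typeIEdge m n j)
      - if i = j then 2 * typeIEdge m n i else 0 := by
  rcases eq_or_ne i j with rfl | hij
  · rw [seidelI_apply_self, typeIEdge_mul_self]
    simp [seidelS]
  · rw [seidelI_apply_of_ne m n hij, if_neg hij, sub_zero]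

lemma seidelI_isHermitian (m n : ℕ) : (seidelI m n).IsHermitian := by
  ext i j
  have hS := (seidelS_isHermitian m n).apply i j
  simp only [star_trivial] at hS
  rcases eq_or_ne i j with rfl | hij
  · simp
  · simp only [conjTranspose_apply, star_trivial]
    rw [seidelI_apply_of_ne m n hij, seidelI_apply_of_ne m n hij.symm, hS,
      mul_comm (typeIEdge m n i)]

lemma seidelI_neg_of_ne {m n : ℕ} (hm : 3 ≤ m) (hn : 3 ≤ n) {i j : Fin m ⊕ Fin n} (hij : i ≠ j) :
    seidelI m n i j < 0 := by
  have hm' : (3 : ℝ) ≤ m := by exact_mod_cast hm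
  have hn' : (3 : ℝ) ≤ n := by exact_mod_cast hn
  have hS : seidelS m n i j < -2 := by
    rcases i with i | i <;> rcases j with j | j <;> simp only [seidelS, if_neg hij] <;> linarith
  have : typeIEdge m n i * typeIEdge m n j ≤ 1 :=
    mul_le_one₀ (typeIEdge_le_one m n i) (typeIEdge_nonneg m n j) (typeIEdge_le_one m n j)
  rw [seidelI_apply_of_ne m n hij]
  linarith

lemma seidelS_quadratic_form (m n : ℕ) (x : Fin m ⊕ Fin n → ℝ) :
    x ⬝ᵥ (seidelS m n *ᵥ x) =
      (2 * n - 1) * (∑ a, x (Sum.inl a) ^ 2 - (∑ a, x (Sum.inl a)) ^ 2)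
      + (2 * m - 1) * (∑ b, x (Sum.inr b) ^ 2 - (∑ b, x (Sum.inr b)) ^ 2)
      - 2 * (2 * (m + n) - 5) * ((∑ a, x (Sum.inl a)) * ∑ b, x (Sum.inr b)) := by
  have hl : ∀ a, (seidelS m n *ᵥ x) (Sum.inl a) = (2 * n - 1) * x (Sum.inl a)
      - (2 * n - 1) * (∑ a, x (Sum.inl a)) - (2 * (m + n) - 5) * ∑ b, x (Sum.inr b) := by
    intro a
    have h : ∀ a' : Fin m, seidelS m n (Sum.inl a) (Sum.inl a') * x (Sum.inl a') =
        (if a = a' then (2 * n - 1) * x (Sum.inl a') else 0)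
          - (2 * n - 1) * x (Sum.inl a') := by
      intro a'
      simp only [seidelS, Sum.inl.injEq]
      split_ifs <;> ring
    simp only [mulVec, dotProduct, Fintype.sum_sum_type, h, Finset.sum_sub_distrib,
      Finset.sum_ite_eq, Finset.mem_univ, if_true, ← Finset.mul_sum]
    simp only [seidelS, reduceCtorEq, if_false, ← Finset.mul_sum]
    ring
  have hr : ∀ b, (seidelS m n *ᵥ x) (Sum.inr b) = (2 * m - 1) * x (Sum.inr b)
      - (2 * m - 1) * (∑ b, x (Sum.inr b)) - (2 * (m + n) - 5) * ∑ a, x (Sum.inl a) := by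
    intro b
    have h : ∀ b' : Fin n, seidelS m n (Sum.inr b) (Sum.inr b') * x (Sum.inr b') =
        (if b = b' then (2 * m - 1) * x (Sum.inr b') else 0)
          - (2 * m - 1) * x (Sum.inr b') := by
      intro b'
      simp only [seidelS, Sum.inr.injEq]
      split_ifs <;> ring
    simp only [mulVec, dotProduct, Fintype.sum_sum_type, h, Finset.sum_sub_distrib,
      Finset.sum_ite_eq, Finset.mem_univ, if_true, ← Finset.mul_sum]
    simp only [seidelS, reduceCtorEq, if_false, ← Finset.mul_sum]
    ring
  have hx : ∀ c d e y : ℝ, y * (c * y - d - e) = c * y ^ 2 - y * (d + e) := by intros; ring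
  simp only [dotProduct, Fintype.sum_sum_type, hl, hr, hx, Finset.sum_sub_distrib,
    ← Finset.mul_sum, ← Finset.sum_mul]
  ring

lemma seidelI_quadratic_form (m n : ℕ) (x : Fin m ⊕ Fin n → ℝ) :
    x ⬝ᵥ (seidelI m n *ᵥ x) = x ⬝ᵥ (seidelS m n *ᵥ x)
      + 2 * (∑ i, typeIEdge m n i * x i) ^ 2 - 2 * ∑ i, typeIEdge m n i * x i ^ 2 := by
  have h : ∀ i j, seidelI m n i j * (x i * x j) = seidelS m n i j * (x i * x j)
      + 2 * ((typeIEdge m n i * x i) * (typeIEdge m n j * x j))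
      - if i = j then 2 * (typeIEdge m n i * x i ^ 2) else 0 := by
    intro i j
    rw [seidelI_apply]
    split_ifs with hij
    · subst hij; ring
    · ring
  rw [Matrix.dotProduct_mulVec_eq_sum, Matrix.dotProduct_mulVec_eq_sum, sq (∑ i, _),
    Finset.sum_mul_sum]
  simp only [h, Finset.sum_sub_distrib, Finset.sum_add_distrib, Finset.sum_ite_eq,
    Finset.mem_univ, if_true, ← Finset.mul_sum]

lemma seidelI_pos_on_sum_zero {m n : ℕ} (hm : 3 ≤ m) (hn : 3 ≤ n) {x : Fin m ⊕ Fin n → ℝ}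
    (hx : x ≠ 0) (hsum : ∑ i, x i = 0) : 0 < x ⬝ᵥ (seidelI m n *ᵥ x) := by
  have hm' : (3 : ℝ) ≤ m := by exact_mod_cast hm
  have hn' : (3 : ℝ) ≤ n := by exact_mod_cast hn
  have hsq : 0 < ∑ i, x i ^ 2 := by
    obtain ⟨i, hi⟩ := Function.ne_iff.1 hx
    exact Finset.sum_pos' (fun _ _ => sq_nonneg _) ⟨i, Finset.mem_univ i, by
      have : x i ≠ 0 := hi
      positivity⟩
  have hedge : ∑ i, typeIEdge m n i * x i ^ 2 ≤ ∑ i, x i ^ 2 :=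
    Finset.sum_le_sum fun i _ => mul_le_of_le_one_left (sq_nonneg _) (typeIEdge_le_one m n i)
  rw [seidelI_quadratic_form, seidelS_quadratic_form]
  rw [Fintype.sum_sum_type] at hsum
  rw [Fintype.sum_sum_type (fun i => x i ^ 2)] at hsq hedge
  have hP : 0 ≤ ∑ a, x (Sum.inl a) ^ 2 := Finset.sum_nonneg fun _ _ => sq_nonneg _
  have hQ : 0 ≤ ∑ b, x (Sum.inr b) ^ 2 := Finset.sum_nonneg fun _ _ => sq_nonneg _
  have hE := sq_nonneg (∑ i, typeIEdge m n i * x i)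
  rw [eq_neg_of_add_eq_zero_right hsum]
  generalize ∑ a, x (Sum.inl a) = s at *
  generalize ∑ a, x (Sum.inl a) ^ 2 = P at *
  generalize ∑ b, x (Sum.inr b) ^ 2 = Q at *
  have h1 : 0 ≤ (2 * n - 6) * P := mul_nonneg (by linarith) hP
  have h2 : 0 ≤ (2 * m - 6) * Q := mul_nonneg (by linarith) hQ
  have h3 : 0 ≤ (2 * (m + n) - 8) * s ^ 2 := mul_nonneg (by linarith) (sq_nonneg s)
  linarith

theorem stmt13 (m n : ℕ) (hm : 3 ≤ m) (hn : 3 ≤ n) :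
    seidelEnergy (seidelI m n) < seidelEnergy (seidelS m n) := by
  have hm0 : 0 < m := by omega
  have hn0 : 0 < n := by omega
  refine Matrix.seidelEnergy_lt_of_le (p := Sum.inl ⟨0, hm0⟩) (q := Sum.inr ⟨0, hn0⟩)
    (seidelS_isHermitian m n) (seidelI_isHermitian m n) (fun i => by simp [seidelS])
    (seidelI_apply_self m n) (fun i j hij => seidelI_neg_of_ne hm hn hij) (fun i j => ?_) ?_
    (fun x hx hsum => seidelI_pos_on_sum_zero hm hn hx hsum)
  · rcases eq_or_ne i j with rfl | hij
    · simp [seidelI_apply_self, seidelS]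
    · rw [seidelI_apply_of_ne m n hij]
      linarith [mul_nonneg (typeIEdge_nonneg m n i) (typeIEdge_nonneg m n j)]
  · rw [seidelI_apply_of_ne m n Sum.inl_ne_inr]
    simp [typeIEdge]
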